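/- Let A be a C*-algebra, E a full Hilbert A-module, and T : E → E a linear map with bounded inverse such that ⟨T(x), T(y)⟩ = γ·⟨x, y⟩ for all x, y ∈ E and some invertible element γ ∈ Z(M(A)). Then γ is positive and T = √γ · U for some unitary A-linear operator U on E; in particular ⟨U(x), U(y)⟩ = ⟨x, y⟩ for all x, y ∈ E and ⟨T(x), y⟩ = √γ·⟨U(x), y⟩ for all x, y ∈ E. -/

import Mathlib

open MultiplierAlgebra

/-- A Hilbert module over a C*-algebra `A`: a (left) `A`-module `E` together with an `A`-valued
inner product which is `ℂ`-linear and `A`-linear in the first variable, conjugate symmetric and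
positive definite, such that the norm of `E` is the induced norm `‖x‖ = ‖⟪x, x⟫‖^(1/2)`
(completeness is the type class `CompleteSpace E`). -/
structure CStarNormedInnerProductModule (A E : Type*) [NonUnitalCStarAlgebra A]
    [PartialOrder A] [StarOrderedRing A]
    [NormedAddCommGroup E] [Module ℂ E] [SMul A E] where
  inner : E → E → A
  add_left : ∀ x y z : E, inner (x + y) z = inner x z + inner y z
  smulC_left : ∀ (c : ℂ) (x y : E), inner (c • x) y = c • inner x y
  smulA_left : ∀ (a : A) (x y : E), inner (a • x) y = a * inner x y
  star_inner : ∀ x y : E, star (inner x y) = inner y x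
  inner_self_nonneg : ∀ x : E, 0 ≤ inner x x
  inner_self_eq_zero : ∀ x : E, inner x x = 0 ↔ x = 0
  smul_add : ∀ (a : A) (x y : E), a • (x + y) = a • x + a • y
  add_smul : ∀ (a b : A) (x : E), (a + b) • x = a • x + b • x
  mul_smul : ∀ (a b : A) (x : E), (a * b) • x = a • (b • x)
  smul_assoc : ∀ (c : ℂ) (a : A) (x : E), (c • a) • x = c • (a • x)
  norm_eq : ∀ x : E, ‖x‖ ^ 2 = ‖inner x x‖

/-- A Hilbert C*-module is *full* when the closed linear span of all inner products is the
whole coefficient algebra. -/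
def CStarNormedInnerProductModule.IsFull {A E : Type*} [NonUnitalCStarAlgebra A]
    [PartialOrder A] [StarOrderedRing A] [NormedAddCommGroup E] [Module ℂ E] [SMul A E]
    (M : CStarNormedInnerProductModule A E) : Prop :=
  (Submodule.span ℂ {a : A | ∃ x y : E, a = M.inner x y}).topologicalClosure = ⊤

open Filter Topology

section CentralElements

variable {B : Type*} [CStarAlgebra B]

lemma negPart_mem_center {a : B} (ha : a ∈ Set.center B) : a⁻ ∈ Set.center B := by
  rw [Semigroup.mem_center_iff] at ha ⊢
  intro g
  rw [CFC.negPart_def]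
  exact ((show Commute a g from (ha g).symm).cfcₙ_real _).eq.symm

variable [PartialOrder B] [StarOrderedRing B]

lemma cfcSqrt_mem_center {a : B} (ha : a ∈ Set.center B) : CFC.sqrt a ∈ Set.center B := by
  rw [Semigroup.mem_center_iff] at ha ⊢
  intro g
  exact ((show Commute a g from (ha g).symm).cfcₙ_nnreal _).eq.symm

lemma negPart_pow_three_mul_eq_zero {a c : B} (ha : IsSelfAdjoint a) (hac : a ∈ Set.center B)
    (hc : 0 ≤ c) (h : 0 ≤ a * c) : a⁻ ^ 3 * c = 0 := by
  have hp : 0 ≤ a⁻ := CFC.negPart_nonneg a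
  have hpc := Semigroup.mem_center_iff.mp (negPart_mem_center hac)
  have hpa : a⁻ * a = -(a⁻ * a⁻) := by
    nth_rewrite 2 [← CFC.posPart_sub_negPart a ha]
    rw [mul_sub, CFC.negPart_mul_posPart, zero_sub]
  apply le_antisymm
  · have h₁ : 0 ≤ a⁻ * (a * c) * a⁻ := conjugate_nonneg_of_nonneg h hp
    have h₂ : a⁻ * (a * c) * a⁻ = -(a⁻ ^ 3 * c) := by
      rw [← mul_assoc, hpa, mul_assoc, hpc, pow_three]
      simp only [neg_mul, mul_assoc, hpc c]
    rwa [h₂, Left.nonneg_neg_iff] at h₁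
  · refine Commute.mul_nonneg (CStarAlgebra.pow_nonneg hp 3) hc ?_
    exact (show Commute a⁻ c from (hpc c).symm).pow_left 3

end CentralElements

namespace DoubleCentralizer

variable {A : Type*} [NonUnitalCStarAlgebra A]

lemma eq_of_forall_mul_left_eq {x y : A} (h : ∀ z : A, z * x = z * y) : x = y := by
  rw [← sub_eq_zero, ← CStarRing.star_mul_self_eq_zero_iff, mul_sub, h, sub_self]

lemma fst_mul_apply (m : 𝓜(ℂ, A)) (a b : A) : m.fst (a * b) = m.fst a * b :=
  eq_of_forall_mul_left_eq fun z => by rw [← m.central, ← mul_assoc, ← mul_assoc, m.central]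

lemma eq_zero_of_fst_eq_zero {m : 𝓜(ℂ, A)} (h : m.fst = 0) : m = 0 := by
  rw [← norm_eq_zero, ← norm_fst, h, norm_zero]

lemma mul_coe (m : 𝓜(ℂ, A)) (a : A) :
    m * (coeHom (𝕜 := ℂ) a) = coeHom (𝕜 := ℂ) (m.fst a) := by
  rw [← sub_eq_zero]
  refine eq_zero_of_fst_eq_zero (ContinuousLinearMap.ext fun b => ?_)
  simp [fst_mul_apply]

lemma fst_mul_apply_of_mem_center {m : 𝓜(ℂ, A)} (hm : m ∈ Set.center 𝓜(ℂ, A)) (a b : A) :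
    m.fst (a * b) = a * m.fst b := by
  have h := congrArg (fun k : 𝓜(ℂ, A) => k.fst b)
    (Semigroup.mem_center_iff.mp hm (coeHom (𝕜 := ℂ) a))
  simpa using h.symm

lemma snd_apply_of_mem_center {m : 𝓜(ℂ, A)} (hm : m ∈ Set.center 𝓜(ℂ, A)) (a : A) :
    m.snd a = m.fst a := by
  rw [← sub_eq_zero, ← CStarRing.mul_star_self_eq_zero_iff, sub_mul, m.central, ← fst_mul_apply,
    fst_mul_apply_of_mem_center hm, sub_self]

lemma star_fst_apply {m : 𝓜(ℂ, A)} (hm : m ∈ Set.center 𝓜(ℂ, A)) (hsa : IsSelfAdjoint m)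
    (a : A) : star (m.fst a) = m.fst (star a) := by
  conv_rhs => rw [← hsa.star_eq, star_fst, star_star, snd_apply_of_mem_center hm]

end DoubleCentralizer

namespace CStarNormedInnerProductModule

variable {A E : Type*} [NonUnitalCStarAlgebra A] [PartialOrder A] [StarOrderedRing A]
  [NormedAddCommGroup E] [Module ℂ E] [SMul A E] (M : CStarNormedInnerProductModule A E)

/-- The Mathlib Hilbert module with the same underlying data; its inner product is linear in the
second variable. -/
abbrev toCStarModule : CStarModule A E where
  inner x y := M.inner y x
  inner_add_right := M.add_left _ _ _
  inner_self_nonneg := M.inner_self_nonneg _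
  inner_self := M.inner_self_eq_zero _
  inner_op_smul_right := M.smulA_left _ _ _
  inner_smul_right_complex := M.smulC_left _ _ _
  star_inner x y := M.star_inner y x
  norm_eq_sqrt_norm_inner_self x := by rw [← M.norm_eq, Real.sqrt_sq (norm_nonneg x)]

lemma sub_left (x y z : E) : M.inner (x - y) z = M.inner x z - M.inner y z :=
  let _ := M.toCStarModule
  CStarModule.inner_sub_right (A := A) (x := z)

lemma sub_right (x y z : E) : M.inner x (y - z) = M.inner x y - M.inner x z :=
  let _ := M.toCStarModule
  CStarModule.inner_sub_left (A := A) (z := x)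

lemma zero_left (x : E) : M.inner 0 x = 0 := by
  rw [← sub_self (0 : E), M.sub_left, sub_self]

lemma norm_inner_le (x y : E) : ‖M.inner x y‖ ≤ ‖x‖ * ‖y‖ := by
  let _ := M.toCStarModule
  rw [mul_comm]
  exact CStarModule.norm_inner_le (A := A) E

lemma smul_right (a : A) (x y : E) : M.inner x (a • y) = M.inner x y * star a := by
  rw [← M.star_inner, M.smulA_left, star_mul, M.star_inner]

lemma ext_inner {x y : E} (h : ∀ z, M.inner x z = M.inner y z) : x = y := by
  rw [← sub_eq_zero, ← M.inner_self_eq_zero, M.sub_left, h, sub_self]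

include M in
lemma norm_fst_smul_sub_le (m : 𝓜(ℂ, A)) (a b : A) (x : E) :
    ‖m.fst a • x - m.fst b • x‖ ≤ ‖m‖ * ‖a • x - b • x‖ := by
  set z := m.fst a • x - m.fst b • x with hz
  have h : M.inner z z = m.fst (M.inner (a • x - b • x) z) := by
    nth_rewrite 1 [hz]
    simp only [M.sub_left, M.smulA_left, map_sub, DoubleCentralizer.fst_mul_apply]
  rcases (norm_nonneg z).eq_or_lt with h₀ | h₀
  · rw [← h₀]; positivity
  · refine le_of_mul_le_mul_right ?_ h₀
    calc ‖z‖ * ‖z‖ = ‖m.fst (M.inner (a • x - b • x) z)‖ := by rw [← h, ← M.norm_eq, sq]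
      _ ≤ ‖m.fst‖ * ‖M.inner (a • x - b • x) z‖ := m.fst.le_opNorm _
      _ ≤ ‖m‖ * (‖a • x - b • x‖ * ‖z‖) := by
        rw [DoubleCentralizer.norm_fst]
        gcongr
        exact M.norm_inner_le _ _
      _ = ‖m‖ * ‖a • x - b • x‖ * ‖z‖ := by ring

include M in
lemma tendsto_approximateUnit_smul (x : E) :
    Tendsto (fun e : A => e • x) (CStarAlgebra.approximateUnit A) (𝓝 x) := by
  have hl := CStarAlgebra.increasingApproximateUnit A
  have h₀ : Tendsto (fun e : A => e * M.inner x x - M.inner x x)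
      (CStarAlgebra.approximateUnit A) (𝓝 0) := by
    simpa using (hl.tendsto_mul_right (M.inner x x)).sub_const (M.inner x x)
  have h₁ : Tendsto (fun e : A => √(2 * ‖e * M.inner x x - M.inner x x‖))
      (CStarAlgebra.approximateUnit A) (𝓝 0) := by
    simpa using (h₀.norm.const_mul 2).sqrt
  rw [tendsto_iff_norm_sub_tendsto_zero]
  refine squeeze_zero' (.of_forall fun _ => norm_nonneg _) ?_ h₁
  filter_upwards [hl.eventually_norm] with e he
  refine Real.le_sqrt_of_sq_le ?_
  set c := M.inner x x
  have h₂ : M.inner (e • x - x) (e • x - x) = (e * c - c) * star e - (e * c - c) := by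
    simp only [M.sub_left, M.sub_right, M.smulA_left, M.smul_right, c, sub_mul, mul_assoc]
    abel
  calc ‖e • x - x‖ ^ 2 = ‖(e * c - c) * star e - (e * c - c)‖ := by rw [M.norm_eq, h₂]
    _ ≤ ‖e * c - c‖ * ‖star e‖ + ‖e * c - c‖ :=
      (norm_sub_le _ _).trans (by gcongr; exact norm_mul_le _ _)
    _ ≤ ‖e * c - c‖ * 1 + ‖e * c - c‖ := by rw [norm_star]; gcongr
    _ = 2 * ‖e * c - c‖ := by ring

/-- Every multiplier of the coefficient algebra acts on a Hilbert module. -/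
lemma exists_inner_eq_fst [CompleteSpace E] (m : 𝓜(ℂ, A)) (x : E) :
    ∃ z : E, ∀ y : E, M.inner z y = m.fst (M.inner x y) := by
  have hl := CStarAlgebra.increasingApproximateUnit A
  have := hl.neBot
  have hx := M.tendsto_approximateUnit_smul x
  have hcauchy : Cauchy (map (fun e : A => m.fst e • x) (CStarAlgebra.approximateUnit A)) := by
    have hc := hx.cauchy_map
    rw [cauchy_map_iff'] at hc ⊢
    rw [Metric.uniformity_eq_comap_nhds_zero, tendsto_comap_iff] at hc ⊢
    refine squeeze_zero (fun _ => dist_nonneg) (fun p => ?_) (by simpa using hc.const_mul ‖m‖)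
    simpa [dist_eq_norm] using M.norm_fst_smul_sub_le m p.1 p.2 x
  obtain ⟨z, hz⟩ := CompleteSpace.complete hcauchy
  refine ⟨z, fun y => ?_⟩
  have h₁ : Tendsto (fun e : A => M.inner (m.fst e • x) y) (CStarAlgebra.approximateUnit A)
      (𝓝 (M.inner z y)) := by
    rw [tendsto_iff_norm_sub_tendsto_zero]
    have h₂ := (tendsto_iff_norm_sub_tendsto_zero.mp (show Tendsto _ _ _ from hz)).mul_const ‖y‖
    rw [zero_mul] at h₂
    refine squeeze_zero (fun _ => norm_nonneg _) (fun e => ?_) h₂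
    rw [← M.sub_left]
    exact M.norm_inner_le _ _
  have h₃ : Tendsto (fun e : A => M.inner (m.fst e • x) y) (CStarAlgebra.approximateUnit A)
      (𝓝 (m.fst (M.inner x y))) := by
    simp only [M.smulA_left, ← DoubleCentralizer.fst_mul_apply]
    exact (m.fst.continuous.tendsto _).comp (hl.tendsto_mul_right _)
  exact tendsto_nhds_unique h₁ h₃

variable {M} in
lemma IsFull.eq_of_fst_inner_eq (hM : M.IsFull) {m n : 𝓜(ℂ, A)}
    (h : ∀ x y : E, m.fst (M.inner x y) = n.fst (M.inner x y)) : m = n := by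
  rw [← sub_eq_zero]
  refine DoubleCentralizer.eq_zero_of_fst_eq_zero ?_
  rw [DoubleCentralizer.sub_fst, sub_eq_zero]
  refine ContinuousLinearMap.ext_on (s := {a : A | ∃ x y : E, a = M.inner x y}) ?_ ?_
  · exact Submodule.dense_iff_topologicalClosure_eq_top.mpr hM
  · rintro _ ⟨x, y, rfl⟩
    exact h x y

lemma fst_inner_eq_zero_of_fst_inner_self [CompleteSpace E] {m : 𝓜(ℂ, A)} {x : E}
    (h : m.fst (M.inner x x) = 0) (y : E) : m.fst (M.inner x y) = 0 := by
  obtain ⟨z, hz⟩ := M.exists_inner_eq_fst m x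
  have h₀ : z = 0 := by
    rw [← M.inner_self_eq_zero, hz, ← M.star_inner z x, hz, h, star_zero, map_zero]
  rw [← hz, h₀, M.zero_left]

variable {M} in
lemma IsFull.multiplier_nonneg [PartialOrder 𝓜(ℂ, A)] [StarOrderedRing 𝓜(ℂ, A)]
    [CompleteSpace E] (hM : M.IsFull) {m : 𝓜(ℂ, A)} (hm : m ∈ Set.center 𝓜(ℂ, A))
    (hsa : IsSelfAdjoint m) (h : ∀ x : E, 0 ≤ m.fst (M.inner x x)) : 0 ≤ m := by
  have h₀ : m⁻ ^ 3 = 0 := by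
    refine hM.eq_of_fst_inner_eq fun x y => ?_
    refine M.fst_inner_eq_zero_of_fst_inner_self ?_ y
    have hx := negPart_pow_three_mul_eq_zero hsa hm
      (map_nonneg (DoubleCentralizer.coeHom (𝕜 := ℂ)) (M.inner_self_nonneg x))
      (by rw [DoubleCentralizer.mul_coe]
          exact map_nonneg (DoubleCentralizer.coeHom (𝕜 := ℂ)) (h x))
    rw [DoubleCentralizer.mul_coe] at hx
    refine DoubleCentralizer.eq_of_forall_mul_left_eq fun z => ?_
    have := congrArg (fun k : 𝓜(ℂ, A) => k.snd z) hx
    simpa using this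
  have h₁ : m⁻ = 0 := by
    have hs := (CFC.negPart_nonneg m).isSelfAdjoint
    have h₄ : m⁻ * m⁻ = 0 := by
      rw [← CStarRing.star_mul_self_eq_zero_iff, star_mul, hs.star_eq]
      calc m⁻ * m⁻ * (m⁻ * m⁻) = m⁻ * m⁻ ^ 3 := by rw [pow_three]; simp only [mul_assoc]
        _ = 0 := by rw [h₀, mul_zero]
    rw [← CStarRing.star_mul_self_eq_zero_iff, hs.star_eq, h₄]
  exact (CFC.negPart_eq_zero_iff m hsa).mp h₁

end CStarNormedInnerProductModule

/-- **Theorem 4.4, special case `T = S`**: if `T` is an invertible linear map with bounded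
inverse on a full Hilbert `A`-module and `⟪T x, T y⟫ = γ · ⟪x, y⟫` for an invertible central
multiplier `γ ∈ Z(M(A))` (acting on `A ⊴ M(A)` via `γ.fst`), then `γ` is positive and
`T = √γ · U` for a unitary `A`-linear operator `U` on `E`; here `√γ` is realized as the
(unique) positive central multiplier `δ` with `δ * δ = γ`, and `T = δ · U` is expressed via
inner products as `⟪T x, y⟫ = δ · ⟪U x, y⟫`. -/
theorem single_map_with_central_multiplier_polar_decomposition
    {A E : Type*} [NonUnitalCStarAlgebra A] [PartialOrder A] [StarOrderedRing A]
    [NormedAddCommGroup E] [Module ℂ E] [SMul A E] [CompleteSpace E]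
    (ME : CStarNormedInnerProductModule A E) (hEfull : ME.IsFull)
    (T : E →ₗ[ℂ] E)
    (T' : E → E) (hT'left : ∀ x : E, T' (T x) = x) (hT'right : ∀ x : E, T (T' x) = x)
    (hT'bdd : ∃ C : ℝ, ∀ x : E, ‖T' x‖ ≤ C * ‖x‖)
    (γ : 𝓜(ℂ, A)) (hγc : γ ∈ Set.center 𝓜(ℂ, A)) (hγu : IsUnit γ)
    (h : ∀ x y : E, ME.inner (T x) (T y) = γ.fst (ME.inner x y)) :
    (∃ b : 𝓜(ℂ, A), γ = star b * b) ∧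
      ∃ δ : 𝓜(ℂ, A), δ ∈ Set.center 𝓜(ℂ, A) ∧ (∃ c : 𝓜(ℂ, A), δ = star c * c) ∧
        δ * δ = γ ∧
        ∃ U U' : E → E,
          (∀ x y : E, U (x + y) = U x + U y) ∧
          (∀ (c : ℂ) (x : E), U (c • x) = c • U x) ∧
          (∀ (a : A) (x : E), U (a • x) = a • U x) ∧
          (∀ x y : E, ME.inner (U x) y = ME.inner x (U' y)) ∧
          (∀ x : E, U' (U x) = x) ∧ (∀ x : E, U (U' x) = x) ∧
          (∀ x y : E, ME.inner (U x) (U y) = ME.inner x y) ∧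
          (∀ x y : E, ME.inner (T x) y = δ.fst (ME.inner (U x) y)) := by
  let _ := CStarAlgebra.spectralOrder 𝓜(ℂ, A)
  have _ := CStarAlgebra.spectralOrderedRing 𝓜(ℂ, A)
  have hγsa : IsSelfAdjoint γ := by
    refine hEfull.eq_of_fst_inner_eq fun x y => ?_
    rw [DoubleCentralizer.star_fst, DoubleCentralizer.snd_apply_of_mem_center hγc, ME.star_inner,
      ← h, ME.star_inner, h]
  have hγ : 0 ≤ γ := hEfull.multiplier_nonneg hγc hγsa fun x => by
    rw [← h]; exact ME.inner_self_nonneg _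
  refine ⟨CStarAlgebra.nonneg_iff_eq_star_mul_self.mp hγ, CFC.sqrt γ, cfcSqrt_mem_center hγc,
    CStarAlgebra.nonneg_iff_eq_star_mul_self.mp (CFC.sqrt_nonneg γ), CFC.sqrt_mul_sqrt_self γ, ?_⟩
  have hδδ := CFC.sqrt_mul_sqrt_self γ
  have hδc := cfcSqrt_mem_center hγc
  have hδsa : IsSelfAdjoint (CFC.sqrt γ) := (CFC.sqrt_nonneg γ).isSelfAdjoint
  obtain ⟨u, hu⟩ : IsUnit (CFC.sqrt γ) := (CFC.isUnit_sqrt_iff γ).mpr hγu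
  rw [← hu] at hδδ hδc hδsa ⊢
  obtain ⟨δ, ε, hδε, hεδ⟩ := u
  dsimp only at hδδ hδc hδsa ⊢
  have hεc : ε ∈ Set.center 𝓜(ℂ, A) := by
    rw [Semigroup.mem_center_iff] at hδc ⊢
    intro g
    calc g * ε = ε * (δ * g) * ε := by rw [← mul_assoc, hεδ, one_mul]
      _ = ε * g := by rw [← hδc, mul_assoc, mul_assoc, hδε, mul_one]
  have hεsa : IsSelfAdjoint ε := by
    refine left_inv_eq_right_inv (a := δ) ?_ hδε
    conv_lhs => rw [← hδsa.star_eq, ← star_mul, hδε, star_one]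
  have hδε' (a : A) : δ.fst (ε.fst a) = a := by
    simpa using congrArg (fun m : 𝓜(ℂ, A) => m.fst a) hδε
  have hεδ' (a : A) : ε.fst (δ.fst a) = a := by
    simpa using congrArg (fun m : 𝓜(ℂ, A) => m.fst a) hεδ
  have hγ' (a : A) : γ.fst a = δ.fst (δ.fst a) := by simp [← hδδ]
  choose act hact using ME.exists_inner_eq_fst
  have hT (a : A) (x : E) : T (a • x) = a • T x := by
    refine ME.ext_inner fun y => ?_
    rw [← hT'right y, h, ME.smulA_left, ME.smulA_left, h,
      DoubleCentralizer.fst_mul_apply_of_mem_center hγc]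
  have hiso (x y : E) : ME.inner (act ε (T x)) (act ε (T y)) = ME.inner x y := by
    rw [hact, ← ME.star_inner, hact, DoubleCentralizer.star_fst_apply hεc hεsa, ME.star_inner, h,
      hγ', hεδ', hεδ']
  have hright (x : E) : act ε (T (T' (act δ x))) = x :=
    ME.ext_inner fun y => by rw [hact, hT'right, hact, hεδ']
  refine ⟨fun x => act ε (T x), fun x => T' (act δ x), fun x y => ?_, fun c x => ?_,
    fun a x => ?_, fun x y => ?_, fun x => ?_, hright, hiso, fun x y => ?_⟩
  · exact ME.ext_inner fun z => by simp only [hact, ME.add_left, map_add]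
  · exact ME.ext_inner fun z => by simp only [hact, ME.smulC_left, map_smul]
  · exact ME.ext_inner fun z => by
      simp only [hact, ME.smulA_left, hT, DoubleCentralizer.fst_mul_apply_of_mem_center hεc]
  · conv_lhs => rw [← hright y]
    exact hiso _ _
  · have : act δ (act ε (T x)) = T x := ME.ext_inner fun z => by rw [hact, hact, hδε']
    simp only [this, hT'left]
  · rw [hact, hδε']
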